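/- Let n ≥ 3 and fix δ > 0 and γ with 0 < γ < min{(p−1)/(q−1), 1/(q−p)}. There exists a constant λ ∈ (0,1), depending only on n, p, q, and δγ, with the following property: for every nonnegative Borel measure σ on ℝⁿ, finite on bounded sets, with W_Gσ(x) < ∞ for every x, every constant c ∈ (0,1), and every Borel function u : ℝⁿ → [0,∞] satisfying u(x) ≥ W_G((f∘u)·dσ)(x) for every x and u(x) ≥ c·(W_Gσ(x))^δ for every x, one has u(x) ≥ (p/q)^(2/(p−1)) · c^(γ(q−1)/(p−1)) · λ · (W_Gσ(x))^(1+δγ) for every x ∈ ℝⁿ. -/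

import Mathlib

open MeasureTheory Metric Set
open scoped ENNReal

noncomputable def gfun (p q : ℝ) (t : ℝ≥0∞) : ℝ≥0∞ := t ^ (p - 1) + t ^ (q - 1)

noncomputable def ffun (p q γ : ℝ) (t : ℝ≥0∞) : ℝ≥0∞ :=
  t ^ ((p - 1) * γ) + t ^ ((q - 1) * γ)

noncomputable def Ffun (p q γ : ℝ) (t : ℝ≥0∞) : ℝ≥0∞ :=
  t ^ ((p - 1) * γ + 1) / ENNReal.ofReal ((p - 1) * γ + 1)
    + t ^ ((q - 1) * γ + 1) / ENNReal.ofReal ((q - 1) * γ + 1)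

/-- The Wolff-type potential `W_G σ(x) = ∫₀^∞ h(σ(B(x,t))/t^(n−1)) dt`,
where `h` is the inverse of `g`. -/
noncomputable def wolffG (n : ℕ) (h : ℝ≥0∞ → ℝ≥0∞)
    (σ : Measure (EuclideanSpace ℝ (Fin n))) (x : EuclideanSpace ℝ (Fin n)) : ℝ≥0∞ :=
  ∫⁻ t in Set.Ioi (0 : ℝ), h (σ (ball x t) / ENNReal.ofReal t ^ (n - 1))

/-- The classical Wolff potential `W_s σ(x) = ∫₀^∞ (σ(B(x,t))/t^(n−1))^(1/(s−1)) dt`. -/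
noncomputable def wolffS (n : ℕ) (s : ℝ)
    (σ : Measure (EuclideanSpace ℝ (Fin n))) (x : EuclideanSpace ℝ (Fin n)) : ℝ≥0∞ :=
  ∫⁻ t in Set.Ioi (0 : ℝ), (σ (ball x t) / ENNReal.ofReal t ^ (n - 1)) ^ (1 / (s - 1))

/-- Condition (A) on the measure σ. -/
def condA (n : ℕ) (p q γ : ℝ) (σ : Measure (EuclideanSpace ℝ (Fin n))) : Prop :=
  ∀ s ∈ ({p, q} : Set ℝ),
    ∀ θ ∈ ({1 / (1 - γ), (p - 1) / (p - 1 - γ * (q - 1)),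
            (q - 1) / (q - 1 - γ * (p - 1))} : Set ℝ),
      (∫⁻ x, Ffun p q γ ((wolffS n s σ x) ^ θ) ∂σ) < ⊤

theorem gfun_strictMono {p q : ℝ} (hp : 1 < p) (hq : 1 < q) : StrictMono (gfun p q) := fun _ _ h =>
  ENNReal.add_lt_add (ENNReal.rpow_lt_rpow h (sub_pos.2 hp)) (ENNReal.rpow_lt_rpow h (sub_pos.2 hq))

theorem gfun_mul_le (p q : ℝ) (hp : 1 ≤ p) (hq : 1 ≤ q) (a b : ℝ≥0∞) :
    gfun p q (a * b) ≤ gfun p q a * gfun p q b := by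
  simp only [gfun, ENNReal.mul_rpow_of_nonneg _ _ (sub_nonneg.2 hp),
    ENNReal.mul_rpow_of_nonneg _ _ (sub_nonneg.2 hq)]
  rw [add_mul]
  gcongr
  · exact le_self_add
  · exact le_add_self

theorem gfun_mul_le_rpow_mul {p q : ℝ} (hp : 1 ≤ p) (hpq : p ≤ q) {a : ℝ≥0∞} (ha : a ≤ 1)
    (b : ℝ≥0∞) : gfun p q (a * b) ≤ a ^ (p - 1) * gfun p q b := by
  simp only [gfun, ENNReal.mul_rpow_of_nonneg _ _ (sub_nonneg.2 hp),
    ENNReal.mul_rpow_of_nonneg _ _ (sub_nonneg.2 (hp.trans hpq))]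
  rw [mul_add]
  exact add_le_add le_rfl
    (mul_le_mul_left (ENNReal.rpow_le_rpow_of_exponent_ge ha (by linarith)) _)

theorem ffun_eq_gfun_rpow (p q γ : ℝ) (t : ℝ≥0∞) : ffun p q γ t = gfun p q (t ^ γ) := by
  simp only [ffun, gfun, ← ENNReal.rpow_mul, mul_comm]

theorem ffun_mono {p q γ : ℝ} (hp : 1 ≤ p) (hq : 1 ≤ q) (hγ : 0 ≤ γ) : Monotone (ffun p q γ) :=
  fun _ _ h => add_le_add
    (ENNReal.rpow_le_rpow h (mul_nonneg (sub_nonneg.2 hp) hγ))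
    (ENNReal.rpow_le_rpow h (mul_nonneg (sub_nonneg.2 hq) hγ))

/-- The mass of an integrable function on `(0, ∞)` can be split into two equal parts. -/
theorem exists_setLIntegral_eq_half {f : ℝ → ℝ≥0∞} (hf : Measurable f)
    (htop : ∫⁻ t in Ioi (0 : ℝ), f t ≠ ⊤) (hzero : ∫⁻ t in Ioi (0 : ℝ), f t ≠ 0) :
    ∃ a : ℝ, 0 < a ∧ ∫⁻ t in Ioc 0 a, f t = (∫⁻ t in Ioi (0 : ℝ), f t) / 2 ∧
      ∫⁻ t in Ioi a, f t = (∫⁻ t in Ioi (0 : ℝ), f t) / 2 := by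
  set M := ∫⁻ t in Ioi (0 : ℝ), f t with hM
  have hMpos : 0 < M.toReal := ENNReal.toReal_pos hzero htop
  have hint : IntegrableOn (fun t => (f t).toReal) (Ioi 0) :=
    integrable_toReal_of_lintegral_ne_top hf.aemeasurable htop
  have hind : Integrable ((Ioi 0).indicator fun t => (f t).toReal) :=
    (integrable_indicator_iff measurableSet_Ioi).2 hint
  have hfin : ∀ᵐ t ∂volume.restrict (Ioi (0 : ℝ)), f t < ⊤ := ae_lt_top hf htop
  have hprim : ∀ b : ℝ, 0 ≤ b →
      ∫ t in (0 : ℝ)..b, (Ioi 0).indicator (fun t => (f t).toReal) t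
        = (∫⁻ t in Ioc 0 b, f t).toReal := by
    intro b hb
    rw [intervalIntegral.integral_of_le hb, ← integral_toReal hf.aemeasurable
      (ae_restrict_of_ae_restrict_of_subset Ioc_subset_Ioi_self hfin)]
    exact setIntegral_congr_fun measurableSet_Ioc fun t ht => indicator_of_mem (mem_Ioi.2 ht.1) _
  have hlim := intervalIntegral_tendsto_integral_Ioi (μ := volume) (0 : ℝ) hint
    (Filter.tendsto_id (α := ℝ) (x := Filter.atTop))
  rw [integral_toReal hf.aemeasurable hfin, ← hM] at hlim
  obtain ⟨b, hb, hb0⟩ :=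
    ((hlim.eventually_const_lt (half_lt_self hMpos)).and (Filter.eventually_ge_atTop 0)).exists
  have hbI : ∫ t in (0 : ℝ)..b, (Ioi 0).indicator (fun t => (f t).toReal) t
      = ∫ t in (0 : ℝ)..b, (f t).toReal := by
    rw [intervalIntegral.integral_of_le hb0, intervalIntegral.integral_of_le hb0]
    exact setIntegral_congr_fun measurableSet_Ioc fun t ht => indicator_of_mem (mem_Ioi.2 ht.1) _
  obtain ⟨a, ha, hGa⟩ := intermediate_value_Icc hb0
    (hind.continuous_primitive (0 : ℝ)).continuousOn
    (show M.toReal / 2 ∈ _ from ⟨by simp only [intervalIntegral.integral_same]; positivity, by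
      simp only [hbI]; exact hb.le⟩)
  have ha0 : 0 < a := by
    refine ha.1.lt_of_ne ?_
    rintro rfl
    simp only [intervalIntegral.integral_same] at hGa
    linarith
  have hadd : (∫⁻ t in Ioc 0 a, f t) + ∫⁻ t in Ioi a, f t = M := by
    rw [hM, ← Ioc_union_Ioi_eq_Ioi ha0.le,
      lintegral_union measurableSet_Ioi (Ioc_disjoint_Ioi le_rfl)]
  have hleft : ∫⁻ t in Ioc 0 a, f t = M / 2 := by
    have hne : ∫⁻ t in Ioc 0 a, f t ≠ ⊤ :=
      ne_top_of_le_ne_top htop (lintegral_mono_set Ioc_subset_Ioi_self)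
    rw [← ENNReal.toReal_eq_toReal_iff' hne (ENNReal.div_ne_top htop two_ne_zero),
      ← hprim a ha0.le, ENNReal.toReal_div]
    simpa using hGa
  refine ⟨a, ha0, hleft, ?_⟩
  have hh : M / 2 + ∫⁻ t in Ioi a, f t = M / 2 + M / 2 := by
    rw [ENNReal.add_halves, ← hleft, hadd]
  exact (ENNReal.add_right_inj (ENNReal.div_ne_top htop two_ne_zero)).1 hh

section Potential

variable {n : ℕ} {p q : ℝ} {h : ℝ≥0∞ → ℝ≥0∞}

theorem le_inverse_gfun (hp : 1 < p) (hq : 1 < q) (hhg : ∀ s, gfun p q (h s) = s) {t s : ℝ≥0∞}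
    (hts : gfun p q t ≤ s) : t ≤ h s :=
  (gfun_strictMono hp hq).le_iff_le.1 (hts.trans_eq (hhg s).symm)

theorem inverse_gfun_mono (hp : 1 < p) (hq : 1 < q) (hhg : ∀ s, gfun p q (h s) = s) :
    Monotone h := fun s _ hst => le_inverse_gfun hp hq hhg ((hhg s).trans_le hst)

theorem measurable_wolffG_integrand (hh : Monotone h)
    (σ : Measure (EuclideanSpace ℝ (Fin n))) (x : EuclideanSpace ℝ (Fin n)) :
    Measurable fun t : ℝ => h (σ (ball x t) / ENNReal.ofReal t ^ (n - 1)) := by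
  have hball : Monotone fun t : ℝ => σ (ball x t) := fun _ _ hst => measure_mono (ball_subset_ball hst)
  exact hh.measurable.comp
    (hball.measurable.div (ENNReal.measurable_ofReal.pow_const _))

/-- The potential at a point of `ball x t` controls the tail at `t` of the potential at `x`. -/
theorem mul_setLIntegral_Ioi_le_wolffG (hp : 1 < p) (hpq : p < q)
    (hhg : ∀ s, gfun p q (h s) = s) {κ : ℝ≥0∞} (hκ : κ ≤ 1) (hκp : κ ^ (p - 1) = 2⁻¹ ^ (n - 1))
    (σ : Measure (EuclideanSpace ℝ (Fin n))) {x y : EuclideanSpace ℝ (Fin n)} {t : ℝ} (ht : 0 < t)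
    (hy : y ∈ ball x t) :
    κ * ∫⁻ s in Ioi t, h (σ (ball x s) / ENNReal.ofReal s ^ (n - 1)) ≤ wolffG n h σ y := by
  have hsub : (fun s : ℝ => 2 * s) '' Ioi t ⊆ Ioi 0 := by
    rintro _ ⟨s, hs, rfl⟩
    have : t < s := hs
    exact mem_Ioi.2 (by simp only; linarith)
  have himage := lintegral_image_eq_lintegral_abs_deriv_mul (s := Ioi t) (f := fun s : ℝ => 2 * s)
    (f' := fun _ => 2) measurableSet_Ioi
    (fun s _ => by simpa using ((hasDerivAt_id s).const_mul (2 : ℝ)).hasDerivWithinAt)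
    (fun a _ b _ hab => by simpa using hab)
    (fun s => h (σ (ball y s) / ENNReal.ofReal s ^ (n - 1)))
  refine le_trans ?_ (lintegral_mono_set hsub)
  rw [himage, ← lintegral_const_mul' _ _ (ne_top_of_le_ne_top ENNReal.one_ne_top hκ)]
  refine setLIntegral_mono' measurableSet_Ioi fun s hs => ?_
  have hts : t < s := hs
  have hball : ball x s ⊆ ball y (2 * s) := by
    refine ball_subset_ball' ?_
    rw [mem_ball, dist_comm] at hy
    linarith
  have hle : κ * h (σ (ball x s) / ENNReal.ofReal s ^ (n - 1)) ≤
      h (σ (ball y (2 * s)) / ENNReal.ofReal (2 * s) ^ (n - 1)) := by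
    refine le_inverse_gfun hp (hp.trans hpq) hhg
      ((gfun_mul_le_rpow_mul hp.le hpq.le hκ _).trans ?_)
    rw [hhg, hκp, ENNReal.ofReal_mul zero_le_two, mul_pow, ENNReal.div_eq_inv_mul,
      ENNReal.div_eq_inv_mul, ENNReal.mul_inv (by simp) (by simp), ENNReal.ofReal_ofNat,
      ENNReal.inv_pow (a := 2), mul_assoc]
    gcongr
  refine hle.trans (le_mul_of_one_le_left' ?_)
  simp

/-- A lower bound for the density near `x` passes to the potential at `x`. -/
theorem mul_setLIntegral_Ioc_le_wolffG_withDensity (hp : 1 < p) (hq : 1 < q)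
    (hhg : ∀ s, gfun p q (h s) = s) (σ : Measure (EuclideanSpace ℝ (Fin n)))
    {w : EuclideanSpace ℝ (Fin n) → ℝ≥0∞} {x : EuclideanSpace ℝ (Fin n)} {a : ℝ} {m : ℝ≥0∞}
    (hw : ∀ y ∈ ball x a, gfun p q m ≤ w y) :
    m * ∫⁻ t in Ioc 0 a, h (σ (ball x t) / ENNReal.ofReal t ^ (n - 1)) ≤
      wolffG n h (σ.withDensity w) x := by
  refine le_trans ?_ (lintegral_mono_set (Ioc_subset_Ioi_self : Ioc 0 a ⊆ Ioi 0))
  rw [← lintegral_const_mul _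
    (measurable_wolffG_integrand (inverse_gfun_mono hp hq hhg) σ x)]
  refine setLIntegral_mono' measurableSet_Ioc fun t ht => ?_
  refine le_inverse_gfun hp hq hhg ((gfun_mul_le p q hp.le hq.le _ _).trans ?_)
  rw [hhg, ← mul_div_assoc]
  gcongr
  rw [withDensity_apply _ measurableSet_ball, ← setLIntegral_const]
  exact setLIntegral_mono' measurableSet_ball fun y hy => hw y (ball_subset_ball ht.2 hy)

end Potential

/-- Claim (iteration step for lower bounds of supersolutions). -/
theorem iteration_claim
    (n : ℕ) (hn : 3 ≤ n) (p q δ γ : ℝ) (hp : 1 < p) (hpq : p < q)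
    (hδ : 0 < δ)
    (hγ0 : 0 < γ) (hγ : γ < min ((p - 1) / (q - 1)) (1 / (q - p)))
    (h : ℝ≥0∞ → ℝ≥0∞)
    (hgh : ∀ t, h (gfun p q t) = t) (hhg : ∀ s, gfun p q (h s) = s) :
    ∃ lam : ℝ, 0 < lam ∧ lam < 1 ∧
      ∀ σ : Measure (EuclideanSpace ℝ (Fin n)),
        (∀ (x : EuclideanSpace ℝ (Fin n)) (r : ℝ), σ (ball x r) < ⊤) →
        (∀ x, wolffG n h σ x < ⊤) →
        ∀ c : ℝ, 0 < c → c < 1 →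
        ∀ u : EuclideanSpace ℝ (Fin n) → ℝ≥0∞, Measurable u →
          (∀ x, wolffG n h (σ.withDensity fun y => ffun p q γ (u y)) x ≤ u x) →
          (∀ x, ENNReal.ofReal c * (wolffG n h σ x) ^ δ ≤ u x) →
          ∀ x, ENNReal.ofReal ((p / q) ^ (2 / (p - 1)) * c ^ (γ * (q - 1) / (p - 1)) * lam)
              * (wolffG n h σ x) ^ (1 + δ * γ) ≤ u x := by
  have hq : 1 < q := hp.trans hpq
  have hp0 : 0 < p - 1 := sub_pos.2 hp
  have hδγ : 0 < δ * γ := mul_pos hδ hγ0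
  set k : ℝ := (2⁻¹ : ℝ) ^ (((n - 1 : ℕ) : ℝ) / (p - 1)) with hk
  have hk0 : 0 < k := by positivity
  have hk1 : k ≤ 1 := Real.rpow_le_one (by norm_num) (by norm_num) (by positivity)
  have hκ1 : ENNReal.ofReal k ≤ 1 := by simpa using hk1
  have hκp : ENNReal.ofReal k ^ (p - 1) = 2⁻¹ ^ (n - 1) := by
    rw [ENNReal.ofReal_rpow_of_pos hk0, hk, ← Real.rpow_mul (by norm_num),
      div_mul_cancel₀ _ hp0.ne', Real.rpow_natCast, ENNReal.ofReal_pow (by norm_num),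
      ENNReal.ofReal_inv_of_pos two_pos, ENNReal.ofReal_ofNat]
  refine ⟨(k / 2) ^ (δ * γ) / 2, by positivity, ?_, ?_⟩
  · have := Real.rpow_le_one (x := k / 2) (z := δ * γ) (by positivity) (by linarith) hδγ.le
    linarith
  intro σ _ hW c hc0 hc1 u _ hsuper hlow x
  have hhmono := inverse_gfun_mono hp hq hhg
  set W := wolffG n h σ x with hWdef
  by_cases hW0 : W = 0
  · simp [hW0, ENNReal.zero_rpow_of_pos (show 0 < 1 + δ * γ by positivity)]
  obtain ⟨a, ha0, hleft, hright⟩ := exists_setLIntegral_eq_half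
    (measurable_wolffG_integrand hhmono σ x) (hW x).ne hW0
  change _ = W / 2 at hleft hright
  have hdens : ∀ y ∈ ball x a,
      gfun p q ((ENNReal.ofReal c * (ENNReal.ofReal k * (W / 2)) ^ δ) ^ γ) ≤ ffun p q γ (u y) := by
    intro y hy
    rw [← ffun_eq_gfun_rpow]
    refine ffun_mono hp.le hq.le hγ0.le (le_trans ?_ (hlow y))
    gcongr
    rw [← hright]
    exact mul_setLIntegral_Ioi_le_wolffG hp hpq hhg hκ1 hκp σ ha0 hy
  refine le_trans ?_ ((mul_setLIntegral_Ioc_le_wolffG_withDensity hp hq hhg σ hdens).trans (hsuper x))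
  rw [hleft]
  have hWr : W = ENNReal.ofReal W.toReal := (ENNReal.ofReal_toReal (hW x).ne).symm
  have hr0 : 0 < W.toReal := ENNReal.toReal_pos hW0 (hW x).ne
  set r := W.toReal
  have hW2 : W / 2 = ENNReal.ofReal (r / 2) := by
    rw [ENNReal.ofReal_div_of_pos two_pos, ← hWr, ENNReal.ofReal_ofNat]
  rw [hW2, hWr, ENNReal.ofReal_rpow_of_pos hr0, ← ENNReal.ofReal_mul hk0.le,
    ENNReal.ofReal_rpow_of_pos (by positivity), ← ENNReal.ofReal_mul hc0.le,
    ENNReal.ofReal_rpow_of_pos (by positivity), ← ENNReal.ofReal_mul (by positivity),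
    ← ENNReal.ofReal_mul (by positivity)]
  refine ENNReal.ofReal_le_ofReal ?_
  have hpq1 : (p / q) ^ (2 / (p - 1)) ≤ 1 :=
    Real.rpow_le_one (by positivity) ((div_le_one (by positivity)).2 hpq.le) (by positivity)
  have hcγ : c ^ (γ * (q - 1) / (p - 1)) ≤ c ^ γ := by
    refine Real.rpow_le_rpow_of_exponent_ge hc0 hc1.le ?_
    rw [le_div_iff₀ hp0]
    gcongr
  have hpow : (c * (k * (r / 2)) ^ δ) ^ γ * (r / 2)
      = 1 * c ^ γ * ((k / 2) ^ (δ * γ) / 2) * r ^ (1 + δ * γ) := by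
    rw [Real.mul_rpow hc0.le (by positivity), ← Real.rpow_mul (by positivity),
      show k * (r / 2) = k / 2 * r by ring, Real.mul_rpow (by positivity) hr0.le,
      Real.rpow_add hr0, Real.rpow_one]
    ring
  rw [hpow]
  gcongr
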